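/- Let d ≥ 1 and n ≥ 1 be integers and B > 1. Then the series ∑_{(a_1,…,a_n) ∈ (ℕ_{>0})^n} q_n(a_1,…,a_n)^{−1} · B^{−g_d(1/2)·n} diverges; consequently λ_d(B, n) ≥ 1/2. -/

import Mathlib

open MeasureTheory Filter Set

/-- `g_n(s)`: `g_1(s) = s`, `g_n(s) = s g_{n-1}(s) / (1 - s + n g_{n-1}(s))` for `n ≥ 2`. -/
noncomputable def gFun : ℕ → ℝ → ℝ
  | 0, s => s
  | 1, s => s
  | n + 2, s => s * gFun (n + 1) s / (1 - s + ((n : ℝ) + 2) * gFun (n + 1) s)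

/-- Continuants: `q_0 = 1`, `q_1 = a_1`, `q_k = a_k q_{k-1} + q_{k-2}` (here `a` is 1-indexed). -/
def contQ (a : ℕ → ℕ) : ℕ → ℕ
  | 0 => 1
  | 1 => a 1
  | k + 2 => a (k + 2) * contQ a (k + 1) + contQ a k

/-- Extend a tuple `(a_1, …, a_n)` of positive integers to a 1-indexed sequence `ℕ → ℕ`. -/
def extendTuple {n : ℕ} (v : Fin n → ℕ+) : ℕ → ℕ :=
  fun i => if h : i - 1 < n ∧ 1 ≤ i then (v ⟨i - 1, h.1⟩ : ℕ) else 1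

/-- `λ_d(B, n) = inf { s ≥ 0 : ∑_{(a_1,…,a_n) ∈ ℕ_{>0}^n} q_n^{-2s} B^{-g_d(s) n} ≤ 1 }`. -/
noncomputable def lambdaBn (d : ℕ) (B : ℝ) (n : ℕ) : ℝ :=
  sInf {s : ℝ | 0 ≤ s ∧
    (∑' v : Fin n → ℕ+,
      ENNReal.ofReal ((contQ (extendTuple v) n : ℝ) ^ (-(2 * s)) * B ^ (-(gFun d s) * (n : ℝ)))) ≤ 1}

theorem aux_gFun (s : ℝ) (hs : 1 ≤ s) (n : ℕ) :
    s / ((n : ℝ) + 1) ≤ gFun (n + 1) s ∧ gFun (n + 1) s ≤ s := by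
  induction n with
  | zero => simp [gFun]
  | succ m ih =>
    obtain ⟨h1, h2⟩ := ih
    have hm : (0 : ℝ) < (m : ℝ) + 1 := by positivity
    rw [div_le_iff₀ hm] at h1
    have hg : 0 < gFun (m + 1) s := by
      by_contra h
      push Not at h
      nlinarith
    have hD : gFun (m + 1) s ≤ 1 - s + ((m : ℝ) + 2) * gFun (m + 1) s := by nlinarith
    have hD0 := lt_of_lt_of_le hg hD
    have hs0 : (0 : ℝ) ≤ s := by linarith
    have e : gFun (m + 1 + 1) s
        = s * gFun (m + 1) s / (1 - s + ((m : ℝ) + 2) * gFun (m + 1) s) := rfl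
    rw [e]
    constructor
    · rw [div_le_div_iff₀ (by positivity) hD0]
      push_cast
      nlinarith
    · rw [div_le_iff₀ hD0]
      nlinarith

theorem aux_contQ (a : ℕ → ℕ) (ha : ∀ i, 1 ≤ a i) (k : ℕ) :
    (∏ i ∈ Finset.range k, a (i + 1) ≤ contQ a k ∧
      contQ a k ≤ ∏ i ∈ Finset.range k, 2 * a (i + 1)) ∧
    (∏ i ∈ Finset.range (k + 1), a (i + 1) ≤ contQ a (k + 1) ∧
      contQ a (k + 1) ≤ ∏ i ∈ Finset.range (k + 1), 2 * a (i + 1)) := by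
  induction k with
  | zero => simp [contQ]; have := ha 1; omega
  | succ m ih =>
    refine ⟨ih.2, ?_⟩
    obtain ⟨⟨h1, h2⟩, h3, h4⟩ := ih
    have e : contQ a (m + 1 + 1) = a (m + 2) * contQ a (m + 1) + contQ a m := rfl
    rw [e, Finset.prod_range_succ _ (m + 1), Finset.prod_range_succ _ (m + 1)]
    have h5 : ∏ i ∈ Finset.range m, 2 * a (i + 1)
        ≤ ∏ i ∈ Finset.range (m + 1), 2 * a (i + 1) := by
      rw [Finset.prod_range_succ]
      have := ha (m + 1)
      exact Nat.le_mul_of_pos_right _ (by omega)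
    have h6 := ha (m + 2)
    have e2 : m + 1 + 1 = m + 2 := rfl
    rw [e2]
    constructor <;> nlinarith

theorem aux_ext {n : ℕ} (v : Fin n → ℕ+) (i : ℕ) : 1 ≤ extendTuple v i := by
  unfold extendTuple
  split
  · exact PNat.one_le _
  · exact le_rfl

theorem aux_bounds {n : ℕ} (v : Fin n → ℕ+) :
    ∏ i, (v i : ℕ) ≤ contQ (extendTuple v) n ∧
      contQ (extendTuple v) n ≤ ∏ i, 2 * (v i : ℕ) := by
  have h := (aux_contQ (extendTuple v) (aux_ext v) n).1
  rw [Finset.prod_range, Finset.prod_range] at h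
  have e : ∀ i : Fin n, extendTuple v (i + 1) = v i := by
    intro i
    simp [extendTuple]
  simpa only [e] using h

theorem aux_div (n : ℕ) (hn : 1 ≤ n) (c : ℝ) (hc : 0 < c) (t : ℝ) (ht : t ≤ 1) :
    (∑' v : Fin n → ℕ+,
      ENNReal.ofReal ((contQ (extendTuple v) n : ℝ) ^ (-t) * c)) = ⊤ := by
  obtain ⟨m, rfl⟩ : ∃ m, n = m + 1 := ⟨n - 1, by omega⟩
  let f : ℕ+ → (Fin (m + 1) → ℕ+) := fun a => Fin.cons a (fun _ => 1)
  have hf : Function.Injective f := by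
    intro a b h
    have := congrFun h 0
    simpa [f] using this
  rw [eq_top_iff]
  refine le_trans ?_ (ENNReal.tsum_comp_le_tsum_of_injective hf _)
  have key : ∀ a : ℕ+, ENNReal.ofReal ((c / 2 ^ (m + 1)) * (1 / ((a : ℕ) : ℝ))) ≤
      ENNReal.ofReal ((contQ (extendTuple (f a)) (m + 1) : ℝ) ^ (-t) * c) := by
    intro a
    apply ENNReal.ofReal_le_ofReal
    obtain ⟨h1, h2⟩ := aux_bounds (f a)
    have ha : 1 ≤ (a : ℕ) := a.one_le
    simp only [f, Fin.prod_univ_succ, Fin.cons_zero, Fin.cons_succ] at h1 h2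
    simp at h1 h2
    have hq1 : (1 : ℝ) ≤ (contQ (extendTuple (f a)) (m + 1) : ℝ) := by
      exact_mod_cast ha.trans h1
    have hq2 : (contQ (extendTuple (f a)) (m + 1) : ℝ) ≤ 2 * (a : ℕ) * 2 ^ m := by
      exact_mod_cast h2
    have h3 : ((contQ (extendTuple (f a)) (m + 1) : ℝ))⁻¹
        ≤ (contQ (extendTuple (f a)) (m + 1) : ℝ) ^ (-t) := by
      rw [← Real.rpow_neg_one]
      exact Real.rpow_le_rpow_of_exponent_le hq1 (by linarith)
    have h4 : (2 * ((a : ℕ) : ℝ) * 2 ^ m)⁻¹ ≤ ((contQ (extendTuple (f a)) (m + 1) : ℝ))⁻¹ :=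
      inv_anti₀ (by linarith) hq2
    have e : (c / 2 ^ (m + 1)) * (1 / ((a : ℕ) : ℝ)) = (2 * ((a : ℕ) : ℝ) * 2 ^ m)⁻¹ * c := by
      have : ((a : ℕ) : ℝ) ≠ 0 := by positivity
      field_simp
      try ring
    rw [e]
    exact mul_le_mul_of_nonneg_right (h4.trans h3) hc.le
  refine le_trans ?_ (ENNReal.tsum_le_tsum key)
  rw [top_le_iff]
  by_contra h
  have hs := ENNReal.summable_toReal h
  have hs2 : Summable (fun a : ℕ+ => (c / 2 ^ (m + 1)) * (1 / ((a : ℕ) : ℝ))) := by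
    refine hs.congr ?_
    intro a
    rw [ENNReal.toReal_ofReal (by positivity)]
  rw [summable_mul_left_iff (by positivity)] at hs2
  exact Real.not_summable_one_div_natCast
    ((summable_pnat_iff_summable_nat (f := fun n : ℕ => 1 / (n : ℝ))).1 hs2)

theorem aux_pi (F : ℕ+ → ENNReal) (hF : ∑' a, F a ≠ ⊤) (n : ℕ) :
    ∑' v : Fin n → ℕ+, ∏ i, F (v i) ≠ ⊤ := by
  induction n with
  | zero => simp
  | succ m ih =>
    rw [← (Fin.consEquiv (fun _ : Fin (m + 1) => ℕ+)).tsum_eq, ENNReal.tsum_prod']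
    simp only [Fin.consEquiv, Equiv.coe_fn_mk, Fin.prod_univ_succ, Fin.cons_zero, Fin.cons_succ,
      ENNReal.tsum_mul_left, ENNReal.tsum_mul_right]
    exact ENNReal.mul_ne_top hF ih

theorem aux_sum (n : ℕ) :
    (∑' v : Fin n → ℕ+, ENNReal.ofReal ((contQ (extendTuple v) n : ℝ) ^ (-2 : ℝ))) ≠ ⊤ := by
  have hF : ∑' a : ℕ+, ENNReal.ofReal (1 / ((a : ℕ) : ℝ) ^ 2) ≠ ⊤ := by
    refine Summable.tsum_ofReal_ne_top ?_
    exact (summable_pnat_iff_summable_nat (f := fun n : ℕ => 1 / (n : ℝ) ^ 2)).2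
      (Real.summable_one_div_nat_pow.2 (by norm_num))
  refine ne_top_of_le_ne_top (aux_pi _ hF n) (ENNReal.tsum_le_tsum fun v => ?_)
  rw [← ENNReal.ofReal_prod_of_nonneg (fun i _ => by positivity)]
  apply ENNReal.ofReal_le_ofReal
  have h1 : ∏ i, ((v i : ℕ) : ℝ) ≤ (contQ (extendTuple v) n : ℝ) := by
    exact_mod_cast (aux_bounds v).1
  have h0 : 0 < ∏ i, ((v i : ℕ) : ℝ) := Finset.prod_pos fun i _ => by
    exact_mod_cast (v i).pos
  rw [Real.rpow_neg (by positivity), Real.rpow_two]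
  simp only [one_div]
  rw [Finset.prod_inv_distrib, Finset.prod_pow]
  exact inv_anti₀ (by positivity) (by gcongr)

/-- The series `∑_{(a_1,…,a_n)} q_n^{-1} B^{-g_d(1/2) n}` diverges; consequently
`λ_d(B, n) ≥ 1/2`. -/
theorem lambdaBn_ge_half (d n : ℕ) (hd : 1 ≤ d) (hn : 1 ≤ n) (B : ℝ) (hB : 1 < B) :
    (∑' v : Fin n → ℕ+,
      ENNReal.ofReal ((contQ (extendTuple v) n : ℝ)⁻¹ * B ^ (-(gFun d (1 / 2)) * (n : ℝ))))
        = ⊤ ∧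
    1 / 2 ≤ lambdaBn d B n := by
  have hB0 : 0 < B := by linarith
  constructor
  · have := aux_div n hn (B ^ (-(gFun d (1 / 2)) * (n : ℝ))) (Real.rpow_pos_of_pos hB0 _) 1 le_rfl
    simpa only [Real.rpow_neg_one] using this
  · unfold lambdaBn
    apply le_csInf
    · obtain ⟨e, rfl⟩ : ∃ e, d = e + 1 := ⟨d - 1, by omega⟩
      obtain ⟨C, hC⟩ : ∃ C, C = ∑' v : Fin n → ℕ+,
        ENNReal.ofReal ((contQ (extendTuple v) n : ℝ) ^ (-2 : ℝ)) := ⟨_, rfl⟩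
      have hCt : C ≠ ⊤ := hC ▸ aux_sum n
      have he : (0 : ℝ) < (e : ℝ) + 1 := by positivity
      obtain ⟨k, hk⟩ := pow_unbounded_of_one_lt C.toReal hB
      have hs : (1 : ℝ) ≤ ((k : ℝ) + 1) * ((e : ℝ) + 1) := by
        have : (0 : ℝ) ≤ k := by positivity
        have : (0 : ℝ) ≤ e := by positivity
        nlinarith
      refine ⟨((k : ℝ) + 1) * ((e : ℝ) + 1), by linarith, ?_⟩
      generalize hs' : ((k : ℝ) + 1) * ((e : ℝ) + 1) = s at hs
      have hg := (aux_gFun s hs e).1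
      rw [← hs', mul_div_cancel_right₀ _ he.ne', hs'] at hg
      have hn' : (1 : ℝ) ≤ n := by exact_mod_cast hn
      have hk0 : (0 : ℝ) ≤ k := by positivity
      have hexp : -(gFun (e + 1) s) * (n : ℝ) ≤ -(k : ℝ) := by nlinarith
      have hb : B ^ (-(gFun (e + 1) s) * (n : ℝ)) ≤ (B ^ k)⁻¹ := by
        rw [← Real.rpow_natCast, ← Real.rpow_neg hB0.le]
        exact Real.rpow_le_rpow_of_exponent_le hB.le hexp
      have hq : ∀ v : Fin n → ℕ+, (1 : ℝ) ≤ (contQ (extendTuple v) n : ℝ) := by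
        intro v
        have h0 : 0 < ∏ i, (v i : ℕ) := Finset.prod_pos fun i _ => (v i).pos
        exact_mod_cast le_trans h0 (aux_bounds v).1
      calc _ ≤ ∑' v : Fin n → ℕ+,
            ENNReal.ofReal ((contQ (extendTuple v) n : ℝ) ^ (-2 : ℝ)) *
              ENNReal.ofReal ((B ^ k)⁻¹) := by
            refine ENNReal.tsum_le_tsum fun v => ?_
            rw [← ENNReal.ofReal_mul (by positivity)]
            apply ENNReal.ofReal_le_ofReal
            apply mul_le_mul _ hb (by positivity) (by positivity)
            exact Real.rpow_le_rpow_of_exponent_le (hq v) (by linarith)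
        _ = C * ENNReal.ofReal ((B ^ k)⁻¹) := by rw [ENNReal.tsum_mul_right, hC]
        _ ≤ 1 := by
            rw [← ENNReal.ofReal_toReal hCt, ← ENNReal.ofReal_mul ENNReal.toReal_nonneg,
              ← ENNReal.ofReal_one]
            apply ENNReal.ofReal_le_ofReal
            rw [← div_eq_mul_inv, div_le_one (by positivity)]
            exact hk.le
    · rintro s ⟨hs0, hs⟩
      by_contra h
      push Not at h
      rw [aux_div n hn _ (Real.rpow_pos_of_pos hB0 _) (2 * s) (by linarith)] at hs
      simp at hs
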